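/- Fix a real number q > 1. For every integer n ≥ 1 and every integer α ≥ 1, there exists a finitely supported c : ℕ × ℕ → ℝ with c(a,b) = 0 unless a ≥ 1 or (a,b) = (0,0), such that vol_{n,α}(x) = Σ_{(a,b)} c(a,b) · q^{a·x} · x^{b} for all integers x ≥ 1. -/

import Mathlib

open Finset

noncomputable section

/-- `μ_m := ∏_{i=1}^{m} (1 − q⁻¹)/(1 − q^{-i})`. -/
def mu (q : ℝ) (m : ℕ) : ℝ :=
  ∏ i ∈ Finset.range m, (1 - q⁻¹) / (1 - q ^ (-((i : ℤ) + 1)))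

/-- For a weakly increasing tuple `λ`, the product `∏_j μ_{n_j}` over the lengths
`(n_1, …, n_s)` of the maximal constant segments of `λ` (equivalently, over the
cardinalities of the fibers of `λ`). -/
def typeProd (q : ℝ) {n : ℕ} (l : Fin n → ℤ) : ℝ :=
  ∏ v ∈ Finset.image l Finset.univ, mu q ((Finset.univ.filter fun i => l i = v).card)

/-- The weight `w_n(λ) := ((∏_j μ_{n_j})/μ_n) · ∏_{i<j} q^{λ_j − λ_i}`. -/
def weight (q : ℝ) {n : ℕ} (l : Fin n → ℤ) : ℝ :=
  (typeProd q l / mu q n) *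
    ∏ p ∈ Finset.univ.filter (fun p : Fin n × Fin n => p.1 < p.2), q ^ (l p.2 - l p.1)

open scoped Classical in
/-- The weakly increasing integer tuples `0 ≤ λ_1 ≤ ⋯ ≤ λ_n ≤ x`. -/
def tuples (n x : ℕ) : Finset (Fin n → ℤ) :=
  (Fintype.piFinset fun _ : Fin n => Finset.Icc (0 : ℤ) (x : ℤ)).filter Monotone

/-- `vol_{n,α}(x) := Σ_{0 ≤ λ_1 ≤ ⋯ ≤ λ_n ≤ x} q^{α(λ_1+⋯+λ_n)} · w_n(λ)`
(for `n = 0` this is `1` by convention, the sum being over the single empty tuple). -/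
def vol (q : ℝ) (n : ℕ) (α : ℤ) (x : ℕ) : ℝ :=
  ∑ l ∈ tuples n x, q ^ (α * ∑ i, l i) * weight q l

/-- The Gaussian binomial coefficient `∏_{i=1}^{β} (q^{n−β+i} − 1)/(q^{i} − 1)`. -/
def gaussBinom (q : ℝ) (n β : ℕ) : ℝ :=
  ∏ i ∈ Finset.range β, (q ^ (n - β + i + 1) - 1) / (q ^ (i + 1) - 1)

/-- Evaluation of a finitely supported family of coefficients `c : ℕ × ℕ → ℝ` as the
`q`-quasi-polynomial `x ↦ Σ_{(a,b)} c(a,b) · q^{a·x} · x^{b}`. -/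
def qQuasiEval (q : ℝ) (c : (ℕ × ℕ) →₀ ℝ) (x : ℕ) : ℝ :=
  c.sum fun p r => r * q ^ (p.1 * x) * (x : ℝ) ^ p.2

end


/-- Basis function `x ↦ q^{a x} x^b`. -/
noncomputable def qpFun (q : ℝ) (p : ℕ × ℕ) : ℕ → ℝ := fun x => q ^ (p.1 * x) * (x : ℝ) ^ p.2

/-- Admissible exponents. -/
def goodExp : Set (ℕ × ℕ) := {p | 1 ≤ p.1 ∨ p = (0, 0)}

/-- The space of admissible quasi-polynomials. -/
noncomputable def goodSpace (q : ℝ) : Submodule ℝ (ℕ → ℝ) :=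
  Submodule.span ℝ (qpFun q '' goodExp)

/-- The operator `f ↦ f(x+1) - Q f(x)`. -/
def shiftOp (Q : ℝ) : (ℕ → ℝ) →ₗ[ℝ] (ℕ → ℝ) where
  toFun f := fun x => f (x + 1) - Q * f x
  map_add' f g := by ext x; simp; ring
  map_smul' r f := by ext x; simp; ring

lemma qpFun_mem (q : ℝ) {p : ℕ × ℕ} (hp : p ∈ goodExp) : qpFun q p ∈ goodSpace q :=
  Submodule.subset_span ⟨p, hp, rfl⟩

lemma shiftOp_qpFun (q Q : ℝ) (a b : ℕ) :
    shiftOp Q (qpFun q (a, b)) = (q ^ a - Q) • qpFun q (a, b) +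
      ∑ j ∈ range b, (q ^ a * (b.choose j : ℝ)) • qpFun q (a, j) := by
  ext x
  simp only [shiftOp, qpFun, LinearMap.coe_mk, AddHom.coe_mk, Pi.add_apply, Pi.smul_apply,
    smul_eq_mul, Finset.sum_apply]
  push_cast
  rw [add_pow, sum_range_succ, mul_add a x 1, pow_add]
  simp only [one_pow, mul_one, Nat.choose_self, Nat.cast_one]
  have : ∑ j ∈ range b, q ^ a * (b.choose j : ℝ) * (q ^ (a * x) * (x : ℝ) ^ j) =
      q ^ (a * x) * q ^ a * ∑ j ∈ range b, (x : ℝ) ^ j * (b.choose j : ℝ) := by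
    rw [mul_sum]
    exact sum_congr rfl fun j _ => by ring
  rw [this]
  ring

lemma qpFun_mem_map (q : ℝ) (hq : 1 < q) (A : ℕ) (hA : 1 ≤ A) (a b : ℕ)
    (h : (a, b) ∈ goodExp) :
    qpFun q (a, b) ∈ (goodSpace q).map (shiftOp (q ^ A)) := by
  induction b using Nat.strong_induction_on with
  | _ b ih =>
  have key : ∀ j < b, qpFun q (a, j) ∈ (goodSpace q).map (shiftOp (q ^ A)) := by
    intro j hj
    apply ih j hj
    rcases h with h | h
    · exact Or.inl h
    · simp at h; omega
  by_cases haA : a = A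
  · subst haA
    have h1 := shiftOp_qpFun q (q ^ a) a (b + 1)
    rw [sub_self, zero_smul, zero_add, sum_range_succ] at h1
    have hmem : shiftOp (q ^ a) (qpFun q (a, b + 1)) ∈ (goodSpace q).map (shiftOp (q ^ a)) :=
      Submodule.mem_map_of_mem (qpFun_mem q (Or.inl hA))
    rw [h1, Submodule.add_mem_iff_right _ (Submodule.sum_mem _ fun j hj =>
      Submodule.smul_mem _ _ (key j (mem_range.1 hj)))] at hmem
    refine (Submodule.smul_mem_iff _ ?_).1 hmem
    have : (0 : ℝ) < q ^ a := by positivity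
    rw [Nat.choose_succ_self_right]
    positivity
  · have h1 := shiftOp_qpFun q (q ^ A) a b
    have hmem : shiftOp (q ^ A) (qpFun q (a, b)) ∈ (goodSpace q).map (shiftOp (q ^ A)) :=
      Submodule.mem_map_of_mem (qpFun_mem q h)
    rw [h1, Submodule.add_mem_iff_left _ (Submodule.sum_mem _ fun j hj =>
      Submodule.smul_mem _ _ (key j (mem_range.1 hj)))] at hmem
    refine (Submodule.smul_mem_iff _ ?_).1 hmem
    rw [sub_ne_zero]
    exact fun h => haA (pow_right_injective₀ (by linarith) (by linarith) h)

lemma goodSpace_le_map (q : ℝ) (hq : 1 < q) (A : ℕ) (hA : 1 ≤ A) :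
    goodSpace q ≤ (goodSpace q).map (shiftOp (q ^ A)) := by
  refine Submodule.span_le.2 ?_
  rintro _ ⟨⟨a, b⟩, h, rfl⟩
  exact qpFun_mem_map q hq A hA a b h

lemma mem_goodSpace_of_rec (q : ℝ) (hq : 1 < q) (A : ℕ) (hA : 1 ≤ A) (f g : ℕ → ℝ)
    (hg : g ∈ goodSpace q) (hf : ∀ x, f (x + 1) = q ^ A * f x + g x) : f ∈ goodSpace q := by
  obtain ⟨h, hh, hhg⟩ := goodSpace_le_map q hq A hA hg
  have : f = h + (f 0 - h 0) • qpFun q (A, 0) := by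
    ext x
    induction x with
    | zero => simp [qpFun]
    | succ x ih =>
      have h2 := congrFun hhg x
      simp only [shiftOp, LinearMap.coe_mk, AddHom.coe_mk] at h2
      rw [hf, ih, ← h2]
      simp [qpFun]
      ring
  rw [this]
  exact add_mem hh (Submodule.smul_mem _ _ (qpFun_mem q (Or.inl hA)))

lemma mu_ne_zero (q : ℝ) (hq : 1 < q) (m : ℕ) : mu q m ≠ 0 := by
  unfold mu
  refine prod_ne_zero_iff.2 fun i _ => div_ne_zero ?_ ?_
  · have := inv_lt_one_of_one_lt₀ hq
    linarith
  · have : q ^ (-((i : ℤ) + 1)) < 1 := zpow_lt_one_of_neg₀ hq (by omega)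
    linarith

lemma typeProd_eq (q : ℝ) {n : ℕ} (l : Fin n → ℤ) (S : Finset ℤ) (hS : ∀ i, l i ∈ S) :
    typeProd q l = ∏ v ∈ S, mu q ((univ.filter fun i => l i = v).card) := by
  unfold typeProd
  refine prod_subset (fun v hv => ?_) fun v _ hv => ?_
  · obtain ⟨i, _, rfl⟩ := mem_image.1 hv
    exact hS i
  · have : (univ.filter fun i => l i = v) = ∅ := by
      ext i
      simp only [mem_filter, mem_univ, true_and, notMem_empty, iff_false]
      intro h
      exact hv (mem_image.2 ⟨i, mem_univ _, h⟩)
    rw [this]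
    simp [mu]

/-- Prepend `m` zeros to the tuple shifted by one. -/
def ext0 (m : ℕ) {k : ℕ} (l : Fin k → ℤ) : Fin (m + k) → ℤ :=
  Fin.append (fun _ => 0) (fun j => l j + 1)

lemma card_ext0 (m : ℕ) {k : ℕ} (l : Fin k → ℤ) (v : ℤ) :
    (univ.filter fun i => ext0 m l i = v).card =
      (if (0 : ℤ) = v then m else 0) + (univ.filter fun j => l j + 1 = v).card := by
  rw [card_filter, Fin.sum_univ_add, card_filter]
  congr 1
  · simp [ext0]
  · simp [ext0]

lemma typeProd_ext0 (q : ℝ) (m : ℕ) {k : ℕ} (l : Fin k → ℤ) (hl : ∀ j, 0 ≤ l j) :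
    typeProd q (ext0 m l) = mu q m * typeProd q l := by
  rw [typeProd_eq q l _ (fun i => mem_image_of_mem l (mem_univ i)),
    typeProd_eq q (ext0 m l) (insert 0 ((univ.image l).map (addRightEmbedding 1)))]
  · rw [prod_insert, prod_map]
    · congr 1
      · rw [card_ext0, if_pos rfl]
        have : (univ.filter fun j => l j + 1 = 0) = ∅ := by
          ext j
          have := hl j
          simp
          omega
        rw [this]
        simp
      · refine prod_congr rfl fun v hv => ?_
        obtain ⟨i, _, rfl⟩ := mem_image.1 hv
        rw [card_ext0, if_neg]
        · simp
        · have := hl i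
          simp
          omega
    · simp only [mem_map, mem_image, mem_univ, true_and, addRightEmbedding_apply]
      rintro ⟨_, ⟨j, rfl⟩, h⟩
      have := hl j
      omega
  · intro i
    refine Fin.addCases (fun i => ?_) (fun j => ?_) i
    · simp [ext0]
    · simp [ext0]

lemma pairProd_ext0 (q : ℝ) (hq : 1 < q) (m : ℕ) {k : ℕ} (l : Fin k → ℤ) :
    ∏ p ∈ univ.filter (fun p : Fin (m + k) × Fin (m + k) => p.1 < p.2),
      q ^ (ext0 m l p.2 - ext0 m l p.1) =
    q ^ ((m : ℤ) * (∑ j, l j + k)) *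
      ∏ p ∈ univ.filter (fun p : Fin k × Fin k => p.1 < p.2), q ^ (l p.2 - l p.1) := by
  have hq0 : q ≠ 0 := by linarith
  rw [prod_filter, prod_filter, Fintype.prod_prod_type, Fintype.prod_prod_type,
    Fin.prod_univ_add]
  congr 1
  · simp only [Fin.prod_univ_add]
    simp only [ext0, Fin.append_left, Fin.append_right, sub_zero, zpow_zero, ite_self,
      prod_const_one, one_mul]
    have : ∀ (i : Fin m) (j : Fin k), Fin.castAdd k i < Fin.natAdd m j := by
      intro i j
      simp only [Fin.lt_def, Fin.val_castAdd, Fin.val_natAdd]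
      omega
    simp only [this, if_true]
    have h2 : ∏ j : Fin k, q ^ (l j + 1) = q ^ (∑ j, l j + k) := by
      have : ∀ s : Finset (Fin k), ∏ j ∈ s, q ^ (l j + 1) = q ^ (∑ j ∈ s, (l j + 1)) := by
        intro s
        induction s using Finset.induction_on with
        | empty => simp
        | insert a s ha ih => rw [prod_insert ha, sum_insert ha, ih, zpow_add₀ hq0 (l a + 1)]
      rw [this, sum_add_distrib]
      simp
    rw [h2]
    simp only [prod_const, card_univ, Fintype.card_fin]
    rw [mul_comm, zpow_mul, zpow_natCast]
  · refine prod_congr rfl fun i _ => ?_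
    rw [Fin.prod_univ_add]
    have : ∀ j : Fin m, ¬ (Fin.natAdd m i < Fin.castAdd k j) := by
      intro j
      simp only [Fin.lt_def, Fin.val_castAdd, Fin.val_natAdd]
      omega
    simp only [this, if_false, prod_const_one, one_mul]
    refine prod_congr rfl fun j _ => ?_
    simp [ext0]

lemma term_ext0 (q : ℝ) (hq : 1 < q) (m : ℕ) {k : ℕ} (α : ℤ) (l : Fin k → ℤ)
    (hl : ∀ j, 0 ≤ l j) :
    q ^ (α * ∑ i, ext0 m l i) * weight q (ext0 m l) =
      (mu q m * mu q k / mu q (m + k) * q ^ ((α + m) * k)) *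
        (q ^ ((α + m) * ∑ i, l i) * weight q l) := by
  have hq0 : q ≠ 0 := by linarith
  have hsum : ∑ i, ext0 m l i = ∑ j, l j + k := by
    rw [Fin.sum_univ_add]
    simp [ext0, sum_add_distrib]
  unfold weight
  rw [hsum, typeProd_ext0 q m l hl, pairProd_ext0 q hq]
  have h1 := mu_ne_zero q hq k
  have h2 : q ^ (α * (∑ j, l j + k)) * q ^ ((m : ℤ) * (∑ j, l j + k)) =
      q ^ ((α + m) * k) * q ^ ((α + m) * ∑ i, l i) := by
    rw [← zpow_add₀ hq0, ← zpow_add₀ hq0]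
    congr 1
    ring
  generalize (∏ p ∈ univ.filter (fun p : Fin k × Fin k => p.1 < p.2), q ^ (l p.2 - l p.1)) = P
  calc _ = (q ^ (α * (∑ j, l j + k)) * q ^ ((m : ℤ) * (∑ j, l j + k))) *
        (mu q m * typeProd q l / mu q (m + k) * P) := by ring
    _ = _ := by
      rw [h2]
      field_simp

lemma mem_tuples {n x : ℕ} {l : Fin n → ℤ} :
    l ∈ tuples n x ↔ (∀ i, 0 ≤ l i ∧ l i ≤ x) ∧ Monotone l := by
  simp [tuples]

lemma ext0_mem (m : ℕ) {k x : ℕ} {l : Fin k → ℤ} (hl : l ∈ tuples k x) :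
    ext0 m l ∈ tuples (m + k) (x + 1) := by
  rw [mem_tuples] at hl ⊢
  obtain ⟨h1, h2⟩ := hl
  refine ⟨fun i => ?_, fun i j => ?_⟩
  · refine Fin.addCases (fun i => ?_) (fun j => ?_) i
    · simp [ext0]
      omega
    · have := h1 j
      simp [ext0]
      omega
  · refine Fin.addCases (fun i => ?_) (fun i => ?_) i <;>
      refine Fin.addCases (fun j => ?_) (fun j => ?_) j
    · simp [ext0]
    · have := h1 j
      simp [ext0]
      omega
    · simp only [Fin.le_def, Fin.val_castAdd, Fin.val_natAdd]
      omega
    · intro hij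
      have : i ≤ j := by
        simp only [Fin.le_def, Fin.val_natAdd] at hij ⊢
        omega
      simpa [ext0] using h2 this

lemma zeros_iff {m k x : ℕ} {l : Fin (m + k) → ℤ} (hl : l ∈ tuples (m + k) x)
    (hc : (univ.filter fun i => l i = 0).card = m) (i : Fin (m + k)) :
    l i = 0 ↔ (i : ℕ) < m := by
  rw [mem_tuples] at hl
  obtain ⟨h1, h2⟩ := hl
  constructor
  · intro h
    have hsub : Finset.Iic i ⊆ univ.filter fun i => l i = 0 := by
      intro j hj
      have := h2 (mem_Iic.1 hj)
      have := (h1 j).1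
      simp
      omega
    have := card_le_card hsub
    rw [hc, Fin.card_Iic] at this
    omega
  · intro h
    by_contra h0
    have hsub : (univ.filter fun i => l i = 0) ⊆ Finset.Iio i := by
      intro j hj
      rw [mem_Iio]
      by_contra hij
      have := h2 (not_lt.1 hij)
      have := (h1 i).1
      simp at hj
      omega
    have := card_le_card hsub
    rw [hc, Fin.card_Iio] at this
    omega

lemma fiber_sum (q : ℝ) (hq : 1 < q) (m k x : ℕ) (α : ℤ) :
    ∑ l ∈ (tuples (m + k) (x + 1)).filter (fun l => (univ.filter fun i => l i = 0).card = m),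
      q ^ (α * ∑ i, l i) * weight q l =
    (mu q m * mu q k / mu q (m + k) * q ^ ((α + m) * k)) * vol q k (α + m) x := by
  unfold vol
  rw [mul_sum]
  symm
  refine sum_bij' (fun l _ => ext0 m l) (fun l _ => fun j => l (Fin.natAdd m j) - 1)
    ?_ ?_ ?_ ?_ ?_
  · intro l hl
    refine mem_filter.2 ⟨ext0_mem m hl, ?_⟩
    rw [mem_tuples] at hl
    rw [card_ext0, if_pos rfl]
    have : (univ.filter fun j => l j + 1 = 0) = ∅ := by
      ext j
      have := (hl.1 j).1
      simp
      omega
    rw [this]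
    simp
  · intro l hl
    obtain ⟨hl, hc⟩ := mem_filter.1 hl
    have hz := zeros_iff hl hc
    rw [mem_tuples] at hl ⊢
    refine ⟨fun j => ?_, fun i j hij => ?_⟩
    · have h1 := hl.1 (Fin.natAdd m j)
      have h2 := hz (Fin.natAdd m j)
      simp only [Fin.val_natAdd] at h2
      push_cast at h1
      have : l (Fin.natAdd m j) ≠ 0 := fun h => by
        have := h2.1 h
        omega
      omega
    · have : Fin.natAdd m i ≤ Fin.natAdd m j := by
        simp only [Fin.le_def, Fin.val_natAdd] at hij ⊢
        omega
      have := hl.2 this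
      simp only
      omega
  · intro l hl
    ext j
    simp [ext0]
  · intro l hl
    obtain ⟨hl, hc⟩ := mem_filter.1 hl
    have hz := zeros_iff hl hc
    ext i
    refine Fin.addCases (fun i => ?_) (fun j => ?_) i
    · have := (hz (Fin.castAdd k i)).2 (by simp)
      simp [ext0, this]
    · simp [ext0]
  · intro l hl
    rw [mem_tuples] at hl
    exact (term_ext0 q hq m α l fun j => (hl.1 j).1).symm

lemma vol_succ (q : ℝ) (hq : 1 < q) (n x : ℕ) (α : ℤ) :
    vol q n α (x + 1) = ∑ m ∈ range (n + 1),
      (mu q m * mu q (n - m) / mu q n * q ^ ((α + m) * (n - m : ℕ))) *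
        vol q (n - m) (α + m) x := by
  have hmaps : ∀ l ∈ tuples n (x + 1), (univ.filter fun i => l i = 0).card ∈ range (n + 1) := by
    intro l _
    rw [mem_range, Nat.lt_succ_iff]
    exact (card_le_univ _).trans (by simp)
  rw [vol, ← sum_fiberwise_of_maps_to hmaps]
  refine sum_congr rfl fun m hm => ?_
  obtain ⟨k, rfl⟩ := Nat.exists_eq_add_of_le (Nat.lt_succ_iff.1 (mem_range.1 hm))
  rw [fiber_sum q hq, Nat.add_sub_cancel_left]

lemma vol_mem (q : ℝ) (hq : 1 < q) (n : ℕ) :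
    ∀ α : ℕ, 1 ≤ α → vol q n (α : ℤ) ∈ goodSpace q := by
  induction n using Nat.strong_induction_on with
  | _ n ih =>
  intro α hα
  rcases Nat.eq_zero_or_pos n with rfl | hn
  · have : vol q 0 (α : ℤ) = qpFun q (0, 0) := by
      ext x
      have h : tuples 0 x = {fun i => i.elim0} := by
        ext l
        rw [mem_tuples, mem_singleton]
        exact ⟨fun _ => Subsingleton.elim _ _,
          fun _ => ⟨fun i => i.elim0, fun i => i.elim0⟩⟩
      rw [vol, h, sum_singleton]
      simp [weight, typeProd, mu, qpFun]
    rw [this]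
    exact qpFun_mem q (Or.inr rfl)
  · refine mem_goodSpace_of_rec q hq (α * n) (Nat.mul_pos hα hn) _
      (∑ m ∈ range n, (mu q (m + 1) * mu q (n - (m + 1)) / mu q n *
        q ^ (((α : ℤ) + (m + 1 : ℕ)) * (n - (m + 1) : ℕ))) •
        vol q (n - (m + 1)) ((α + (m + 1) : ℕ) : ℤ)) ?_ ?_
    · refine Submodule.sum_mem _ fun m hm => Submodule.smul_mem _ _ ?_
      exact ih _ (by omega) _ (by omega)
    · intro x
      rw [vol_succ q hq, sum_range_succ', add_comm]
      congr 1
      · have h1 := mu_ne_zero q hq n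
        have h0 : mu q 0 = 1 := by simp [mu]
        rw [h0]
        simp only [Nat.sub_zero, Nat.cast_zero, add_zero, one_mul]
        rw [div_self h1, one_mul, ← Nat.cast_mul, zpow_natCast]
      · simp only [Finset.sum_apply, Pi.smul_apply, smul_eq_mul]
        push_cast
        rfl

/-- **Expansion of `vol_{n,α}` for `α ≥ 1`.** For `q > 1`, `n ≥ 1` and `α ≥ 1`, the function
`x ↦ vol_{n,α}(x)` admits a `q`-quasi-polynomial expansion whose coefficient at `q^{a x} x^b`
vanishes unless `a ≥ 1` or `(a,b) = (0,0)`. -/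
theorem vol_qQuasiPolynomial_of_one_le (q : ℝ) (hq : 1 < q) (n : ℕ) (hn : 1 ≤ n)
    (α : ℤ) (hα : 1 ≤ α) :
    ∃ c : (ℕ × ℕ) →₀ ℝ,
      (∀ a b : ℕ, c (a, b) ≠ 0 → 1 ≤ a ∨ (a, b) = (0, 0)) ∧
      ∀ x : ℕ, 1 ≤ x → vol q n α x = qQuasiEval q c x := by
  obtain ⟨k, rfl⟩ := Int.eq_ofNat_of_zero_le (show 0 ≤ α by omega)
  have hmem := vol_mem q hq n k (by omega)
  obtain ⟨c, hc, hcv⟩ := (Finsupp.mem_span_image_iff_linearCombination ℝ).1 hmem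
  refine ⟨c, fun a b hab => (Finsupp.mem_supported ℝ c).1 hc (Finsupp.mem_support_iff.2 hab),
    fun x _ => ?_⟩
  rw [← hcv, Finsupp.linearCombination_apply, qQuasiEval, Finsupp.sum, Finsupp.sum,
    Finset.sum_apply]
  refine Finset.sum_congr rfl fun p _ => ?_
  simp only [Pi.smul_apply, smul_eq_mul, qpFun]
  ring
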